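/- arXiv:2309.11005 — 2 statements merged into one kernel-verified Lean document; each statement's English description precedes it below -/
import Mathlib

section
/- Fix σ > 0 and L > 0. The function h : ℝ → ℝ defined by h(ε) = Φ(L/(2σ) − εσ/L) − e^ε·Φ(−L/(2σ) − εσ/L) has derivative h'(ε) = −e^ε·Φ(−L/(2σ) − εσ/L) at every ε, and consequently h is strictly monotone decreasing on [0, ∞). -/
open MeasureTheory ProbabilityTheory Real

/-- The cumulative distribution function `Φ` of the standard Gaussian `N(0,1)`. -/
noncomputable def stdGaussianCDF (x : ℝ) : ℝ :=
  ((gaussianReal 0 1) (Set.Iic x)).toReal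

lemma stdGaussianCDF_eq_integral (x : ℝ) :
    stdGaussianCDF x = ∫ t in Set.Iic x, gaussianPDFReal 0 1 t := by
  rw [stdGaussianCDF, gaussianReal_apply_eq_integral 0 one_ne_zero,
    ENNReal.toReal_ofReal]
  exact integral_nonneg fun t => gaussianPDFReal_nonneg 0 1 t

lemma hasDerivAt_stdGaussianCDF (x : ℝ) :
    HasDerivAt stdGaussianCDF (gaussianPDFReal 0 1 x) x := by
  have hint := integrable_gaussianPDFReal 0 1
  have hcont : Continuous (gaussianPDFReal 0 1) := by
    unfold gaussianPDFReal
    fun_prop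
  have heq : stdGaussianCDF =
      fun y => stdGaussianCDF 0 + ∫ t in (0 : ℝ)..y, gaussianPDFReal 0 1 t := by
    funext y
    rw [← intervalIntegral.integral_Iic_sub_Iic hint.integrableOn hint.integrableOn,
      ← stdGaussianCDF_eq_integral, ← stdGaussianCDF_eq_integral]
    ring
  rw [heq]
  exact (hcont.integral_hasStrictDerivAt 0 x).hasDerivAt.const_add _

lemma stdGaussianCDF_pos (x : ℝ) : 0 < stdGaussianCDF x := by
  rw [stdGaussianCDF_eq_integral]
  refine (setIntegral_pos_iff_support_of_nonneg_ae
    (Filter.Eventually.of_forall fun t => gaussianPDFReal_nonneg 0 1 t)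
    (integrable_gaussianPDFReal 0 1).integrableOn).2 ?_
  have hsupp : Function.support (gaussianPDFReal 0 1) = Set.univ :=
    Set.eq_univ_of_forall fun t => (gaussianPDFReal_pos 0 1 t one_ne_zero).ne'
  simp [hsupp]

lemma gaussianPDFReal_sub_eq_exp_mul (a t : ℝ) :
    gaussianPDFReal 0 1 (a - t) = exp (2 * a * t) * gaussianPDFReal 0 1 (-a - t) := by
  simp only [gaussianPDFReal, NNReal.coe_one]
  rw [mul_left_comm, ← exp_add]
  ring_nf

/-- **Monotone decrease in `ε`.** For fixed `σ > 0` and `L > 0`, the function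
`h(ε) = Φ(L/(2σ) − εσ/L) − e^ε·Φ(−L/(2σ) − εσ/L)` has derivative
`h'(ε) = −e^ε·Φ(−L/(2σ) − εσ/L)` at every `ε`, and is strictly decreasing on `[0, ∞)`. -/
theorem delta_deriv_and_strictAntiOn_eps (σ L : ℝ) (hσ : 0 < σ) (hL : 0 < L) :
    (∀ ε : ℝ,
      HasDerivAt
        (fun ε : ℝ => stdGaussianCDF (L / (2 * σ) - ε * σ / L) -
          Real.exp ε * stdGaussianCDF (-(L / (2 * σ)) - ε * σ / L))
        (-(Real.exp ε * stdGaussianCDF (-(L / (2 * σ)) - ε * σ / L))) ε) ∧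
    StrictAntiOn
      (fun ε : ℝ => stdGaussianCDF (L / (2 * σ) - ε * σ / L) -
        Real.exp ε * stdGaussianCDF (-(L / (2 * σ)) - ε * σ / L))
      (Set.Ici (0 : ℝ)) := by
  have hderiv : ∀ ε : ℝ,
      HasDerivAt
        (fun ε : ℝ => stdGaussianCDF (L / (2 * σ) - ε * σ / L) -
          Real.exp ε * stdGaussianCDF (-(L / (2 * σ)) - ε * σ / L))
        (-(Real.exp ε * stdGaussianCDF (-(L / (2 * σ)) - ε * σ / L))) ε := by
    intro ε
    have hlin : ∀ c : ℝ, HasDerivAt (fun ε : ℝ => c - ε * σ / L) (-(1 * σ / L)) ε :=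
      fun c => (((hasDerivAt_id ε).mul_const σ).div_const L).const_sub c
    have hfst := (hasDerivAt_stdGaussianCDF (L / (2 * σ) - ε * σ / L)).comp ε (hlin _)
    have hsnd := (hasDerivAt_stdGaussianCDF (-(L / (2 * σ)) - ε * σ / L)).comp ε (hlin _)
    have hpdf := gaussianPDFReal_sub_eq_exp_mul (L / (2 * σ)) (ε * σ / L)
    have hexp : 2 * (L / (2 * σ)) * (ε * σ / L) = ε := by field_simp
    rw [hexp] at hpdf
    refine (hfst.sub ((Real.hasDerivAt_exp ε).mul hsnd)).congr_deriv ?_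
    simp only [Function.comp_apply]
    rw [hpdf]
    ring
  refine ⟨hderiv, ?_⟩
  refine StrictAnti.strictAntiOn (strictAnti_of_deriv_neg fun ε => ?_) _
  rw [(hderiv ε).deriv]
  exact neg_neg_of_pos (mul_pos (exp_pos ε) (stdGaussianCDF_pos _))
end

section
/- Let σ > 0, x ∈ ℝ, ε ≥ 0, δ ∈ [0,1] and L > 0 satisfy Φ(L/(2σ) − εσ/L) − e^ε·Φ(−L/(2σ) − εσ/L) ≤ δ. Let f_i, f_j : ℝ → ℝ be measurable with 0 ≤ f_i ≤ 1 and 0 ≤ f_j ≤ 1, and define the smoothed expectations E_i(t) = ∫ f_i dN(t, σ²) and E_j(t) = ∫ f_j dN(t, σ²). If E_i(x) − e^{2ε}·E_j(x) − (1 + e^ε)·δ ≥ 0, then for every γ ∈ ℝ with |γ| ≤ L one has E_i(x + γ) ≥ E_j(x + γ). -/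
open MeasureTheory ProbabilityTheory Real

lemma integrable_gaussianReal_of_mem_Icc {f : ℝ → ℝ} (hf : Measurable f) (hf0 : ∀ y, 0 ≤ f y)
    (hf1 : ∀ y, f y ≤ 1) (m : ℝ) (v : NNReal) : Integrable f (gaussianReal m v) :=
  .of_bound hf.aestronglyMeasurable 1 (.of_forall fun y ↦ by
    rw [Real.norm_eq_abs, abs_of_nonneg (hf0 y)]; exact hf1 y)

lemma stdGaussianCDF_mono : Monotone stdGaussianCDF := fun _ _ h ↦
  ENNReal.toReal_mono (measure_ne_top _ _) (measure_mono (Set.Iic_subset_Iic.2 h))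

lemma integral_indicator_Iic_gaussianReal (d t : ℝ) :
    ∫ y, (Set.Iic t).indicator 1 y ∂(gaussianReal d 1) = stdGaussianCDF (t - d) := by
  have h := gaussianReal_map_add_const (μ := 0) (v := 1) d
  rw [zero_add] at h
  rw [integral_indicator_one measurableSet_Iic, Measure.real, ← h,
    Measure.map_apply (measurable_add_const d) measurableSet_Iic, stdGaussianCDF]
  congr 2
  ext y
  simp [le_sub_iff_add_le]

lemma exp_mul_gaussianPDFReal_le_iff {d ε : ℝ} (hd : 0 < d) (y : ℝ) :
    exp ε * gaussianPDFReal d 1 y ≤ gaussianPDFReal 0 1 y ↔ y ≤ d / 2 - ε / d := by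
  have hc : 0 < (√(2 * π * (1 : NNReal)))⁻¹ := by
    have := pi_pos
    simp only [NNReal.coe_one]
    positivity
  rw [gaussianPDFReal, gaussianPDFReal, mul_left_comm, mul_le_mul_iff_right₀ hc, ← exp_add,
    exp_le_exp, ← mul_le_mul_iff_left₀ hd (b := y), sub_mul, div_mul_cancel₀ _ hd.ne']
  simp only [NNReal.coe_one]
  constructor <;> intro h <;> nlinarith

/-- Neyman–Pearson: among tests with values in `[0, 1]`, a half-line maximises the hockey-stick
functional between `N(0,1)` and `N(d,1)`. -/
lemma integral_sub_exp_mul_integral_le {d ε : ℝ} (hd : 0 < d) {f : ℝ → ℝ} (hf : Measurable f)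
    (hf0 : ∀ y, 0 ≤ f y) (hf1 : ∀ y, f y ≤ 1) :
    ∫ y, f y ∂(gaussianReal 0 1) - exp ε * ∫ y, f y ∂(gaussianReal d 1) ≤
      stdGaussianCDF (d / 2 - ε / d) - exp ε * stdGaussianCDF (-(d / 2) - ε / d) := by
  have hint {g : ℝ → ℝ} (hg : Measurable g) (hg0 : ∀ y, 0 ≤ g y) (hg1 : ∀ y, g y ≤ 1) (m : ℝ) :
      Integrable fun y ↦ gaussianPDFReal m 1 y * g y :=
    (integrable_gaussianPDFReal m 1).mul_bdd (c := 1) hg.aestronglyMeasurable (.of_forall fun y ↦ by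
      rw [Real.norm_eq_abs, abs_of_nonneg (hg0 y)]; exact hg1 y)
  have hs := measurableSet_Iic (a := d / 2 - ε / d)
  set g : ℝ → ℝ := (Set.Iic (d / 2 - ε / d)).indicator 1 with hg
  have hgm : Measurable g := measurable_one.indicator hs
  have hg0 (y : ℝ) : 0 ≤ g y := Set.indicator_nonneg (fun _ _ ↦ zero_le_one) y
  have hg1 (y : ℝ) : g y ≤ 1 := Set.indicator_le_self' (fun _ _ ↦ zero_le_one) y
  have h0 := integral_indicator_Iic_gaussianReal 0 (d / 2 - ε / d)
  have h1 := integral_indicator_Iic_gaussianReal d (d / 2 - ε / d)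
  rw [sub_zero] at h0
  rw [show -(d / 2) - ε / d = d / 2 - ε / d - d by ring, ← h0, ← h1, ← hg]
  simp only [integral_gaussianReal_eq_integral_smul one_ne_zero, smul_eq_mul]
  rw [← integral_const_mul, ← integral_const_mul,
    ← integral_sub (hint hf hf0 hf1 0) ((hint hf hf0 hf1 d).const_mul _),
    ← integral_sub (hint hgm hg0 hg1 0) ((hint hgm hg0 hg1 d).const_mul _)]
  refine integral_mono ((hint hf hf0 hf1 0).sub ((hint hf hf0 hf1 d).const_mul _))
    ((hint hgm hg0 hg1 0).sub ((hint hgm hg0 hg1 d).const_mul _)) fun y ↦ ?_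
  have key := exp_mul_gaussianPDFReal_le_iff (ε := ε) hd y
  by_cases hy : y ≤ d / 2 - ε / d
  · have hgy : g y = 1 := Set.indicator_of_mem (Set.mem_Iic.2 hy) _
    simp only [hgy]
    nlinarith [key.2 hy, hf1 y]
  · have hgy : g y = 0 := Set.indicator_of_notMem (fun h ↦ hy (Set.mem_Iic.1 h)) _
    simp only [hgy]
    nlinarith [not_le.1 (mt key.1 hy), hf0 y]

/-- The hockey-stick bound between `N(0,1)` and `N(l,1)` also controls every smaller shift. -/
lemma integral_sub_exp_mul_integral_le_of_le {d l ε : ℝ} (hd : 0 < d) (hdl : d ≤ l) {f : ℝ → ℝ}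
    (hf : Measurable f) (hf0 : ∀ y, 0 ≤ f y) (hf1 : ∀ y, f y ≤ 1) :
    ∫ y, f y ∂(gaussianReal 0 1) - exp ε * ∫ y, f y ∂(gaussianReal d 1) ≤
      stdGaussianCDF (l / 2 - ε / l) - exp ε * stdGaussianCDF (-(l / 2) - ε / l) := by
  refine (integral_sub_exp_mul_integral_le hd hf hf0 hf1).trans ?_
  have h := integral_sub_exp_mul_integral_le (ε := ε) (hd.trans_le hdl)
    (f := (Set.Iic (d / 2 - ε / d)).indicator 1) (measurable_one.indicator measurableSet_Iic)
    (Set.indicator_nonneg fun _ _ ↦ zero_le_one) (Set.indicator_le_self' fun _ _ ↦ zero_le_one)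
  rw [integral_indicator_Iic_gaussianReal, integral_indicator_Iic_gaussianReal, sub_zero] at h
  have hmono : stdGaussianCDF (d / 2 - ε / d - l) ≤ stdGaussianCDF (-(d / 2) - ε / d) :=
    stdGaussianCDF_mono (by linarith)
  nlinarith [exp_pos ε]

lemma integral_gaussianReal_affine {f : ℝ → ℝ} (hf : Measurable f) (a c m : ℝ) :
    ∫ y, f (a + c * y) ∂(gaussianReal m 1) =
      ∫ y, f y ∂(gaussianReal (a + c * m) ⟨c ^ 2, sq_nonneg c⟩) := by
  have h : (gaussianReal m 1).map (fun y ↦ a + c * y) =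
      gaussianReal (a + c * m) ⟨c ^ 2, sq_nonneg c⟩ := by
    have hcomp : (fun y ↦ a + c * y) = (fun y ↦ a + y) ∘ fun y ↦ c * y := rfl
    rw [hcomp, ← Measure.map_map (measurable_const_add a) (measurable_const_mul c),
      gaussianReal_map_const_mul, gaussianReal_map_const_add, mul_one, add_comm]
    rfl
  rw [← h, integral_map (by fun_prop) hf.aestronglyMeasurable]

/-- The Gaussian mechanism with noise scale `σ` is `(ε, δ)`-differentially private for shifts of
size at most `L`. -/
lemma integral_gaussianReal_le_exp_mul_add {σ ε δ L a b : ℝ} (hσ : 0 < σ) (hε : 0 ≤ ε)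
    (hδ : 0 ≤ δ)
    (hcond : stdGaussianCDF (L / (2 * σ) - ε * σ / L) -
      exp ε * stdGaussianCDF (-(L / (2 * σ)) - ε * σ / L) ≤ δ)
    (hab : |b - a| ≤ L) {f : ℝ → ℝ} (hf : Measurable f) (hf0 : ∀ y, 0 ≤ f y)
    (hf1 : ∀ y, f y ≤ 1) :
    ∫ y, f y ∂(gaussianReal a ⟨σ ^ 2, sq_nonneg σ⟩) ≤
      exp ε * ∫ y, f y ∂(gaussianReal b ⟨σ ^ 2, sq_nonneg σ⟩) + δ := by
  have of_pos_shift {c d : ℝ} (hc : c ^ 2 = σ ^ 2) (hd : 0 < d) (hdl : d ≤ L / σ)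
      (hb : b = a + c * d) : ∫ y, f y ∂(gaussianReal a ⟨σ ^ 2, sq_nonneg σ⟩) ≤
        exp ε * ∫ y, f y ∂(gaussianReal b ⟨σ ^ 2, sq_nonneg σ⟩) + δ := by
    have h := integral_sub_exp_mul_integral_le_of_le (ε := ε) hd hdl
      (f := fun y ↦ f (a + c * y)) (by fun_prop) (fun y ↦ hf0 _) fun y ↦ hf1 _
    rw [integral_gaussianReal_affine hf, integral_gaussianReal_affine hf, mul_zero, add_zero,
      ← hb, div_div, div_div_eq_mul_div, mul_comm σ 2] at h
    simp only [hc] at h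
    linarith
  rcases lt_trichotomy a b with h | rfl | h
  · refine of_pos_shift (c := σ) (d := (b - a) / σ) rfl (div_pos (sub_pos.2 h) hσ) ?_ ?_
    · gcongr
      exact (le_abs_self _).trans hab
    · field_simp
      ring
  · have := mul_le_mul_of_nonneg_right (one_le_exp hε)
      (integral_nonneg hf0 (μ := gaussianReal a ⟨σ ^ 2, sq_nonneg σ⟩))
    linarith
  · refine of_pos_shift (c := -σ) (d := (a - b) / σ) (neg_sq σ) (div_pos (sub_pos.2 h) hσ) ?_ ?_
    · gcongr
      rw [← neg_sub]
      exact (neg_le_abs _).trans hab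
    · field_simp
      ring

/-- **The improved differential-privacy certification (Equation (13)).**
If `Φ(L/(2σ) − εσ/L) − e^ε·Φ(−L/(2σ) − εσ/L) ≤ δ` and the smoothed expectations
`E_i(t) = ∫ f_i dN(t, σ²)` satisfy `E_i(x) − e^{2ε}·E_j(x) − (1 + e^ε)·δ ≥ 0`, then
`E_i(x + γ) ≥ E_j(x + γ)` for every perturbation `γ` with `|γ| ≤ L`. -/
theorem certified_radius (σ x ε δ L : ℝ) (hσ : 0 < σ) (hε : 0 ≤ ε)
    (hδ0 : 0 ≤ δ) (hδ1 : δ ≤ 1) (hL : 0 < L)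
    (hcond : stdGaussianCDF (L / (2 * σ) - ε * σ / L) -
      Real.exp ε * stdGaussianCDF (-(L / (2 * σ)) - ε * σ / L) ≤ δ)
    (fi fj : ℝ → ℝ) (hfi : Measurable fi) (hfj : Measurable fj)
    (hfi0 : ∀ y, 0 ≤ fi y) (hfi1 : ∀ y, fi y ≤ 1)
    (hfj0 : ∀ y, 0 ≤ fj y) (hfj1 : ∀ y, fj y ≤ 1)
    (hgap : (∫ y, fi y ∂(gaussianReal x ⟨σ ^ 2, sq_nonneg σ⟩)) -
        Real.exp (2 * ε) * (∫ y, fj y ∂(gaussianReal x ⟨σ ^ 2, sq_nonneg σ⟩)) -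
        (1 + Real.exp ε) * δ ≥ 0) :
    ∀ γ : ℝ, |γ| ≤ L →
      (∫ y, fi y ∂(gaussianReal (x + γ) ⟨σ ^ 2, sq_nonneg σ⟩)) ≥
        ∫ y, fj y ∂(gaussianReal (x + γ) ⟨σ ^ 2, sq_nonneg σ⟩) := by
  intro γ hγ
  have hi := integral_gaussianReal_le_exp_mul_add (a := x) (b := x + γ) hσ hε hδ0 hcond
    (by simpa using hγ) hfi hfi0 hfi1
  have hj := integral_gaussianReal_le_exp_mul_add (a := x + γ) (b := x) hσ hε hδ0 hcond
    (by simpa using hγ) hfj hfj0 hfj1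
  have hj' := mul_le_mul_of_nonneg_left hj (exp_pos ε).le
  rw [two_mul, exp_add] at hgap
  refine le_of_mul_le_mul_left ?_ (exp_pos ε)
  linarith
end
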